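/- arXiv:1105.2709 — 2 statements merged into one kernel-verified Lean document; each statement's English description precedes it below -/
import Mathlib

section
/- Let φ_1, …, φ_5 ∈ ℂ^3 and ψ_1, …, ψ_5 ∈ ℂ^3 be such that every triple of the φ's is linearly independent and every triple of the ψ's is linearly independent. Then the following are equivalent: (i) there exist A, B ∈ SL(3,ℂ) and nonzero scalars c_1, …, c_5 ∈ ℂ such that the product vectors c_i·(A φ_i) ⊗ (B ψ_i) form an orthogonal Unextendible Product Basis {v_i ⊗ w_i}_{i=1}^5 with orthogonality relations ⟨v_i, v_{(i mod 5)+1}⟩ = 0 and ⟨w_j, w_{((j+1) mod 5)+1}⟩ = 0 for all i, j = 1, …, 5; (ii) the invariants s_1, s_2 (computed from the φ's) and s_3, s_4 (computed from the ψ's) are all positive real numbers. -/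
open scoped ComplexConjugate

/-- The standard Hermitian inner product, conjugate-linear in the first argument. -/
noncomputable def hinner {α : Type*} [Fintype α] (x y : α → ℂ) : ℂ :=
  ∑ a, conj (x a) * y a

/-- The product vector `φ ⊗ ψ` in `ℂ^n ⊗ ℂ^m`, identified with `Fin n × Fin m → ℂ`. -/
noncomputable def prodVec {n m : ℕ} (φ : Fin n → ℂ) (ψ : Fin m → ℂ) :
    Fin n × Fin m → ℂ :=
  fun p => φ p.1 * ψ p.2

/-- Determinant of the 3×3 matrix with columns `u`, `v`, `w`. -/
noncomputable def det3 (u v w : Fin 3 → ℂ) : ℂ :=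
  Matrix.det (Matrix.of fun i j => ![u, v, w] j i)

/-- The invariant `s₁` of five vectors in `ℂ^3`. -/
noncomputable def s1 (φ : Fin 5 → Fin 3 → ℂ) : ℂ :=
  (-(det3 (φ 0) (φ 1) (φ 3) * det3 (φ 0) (φ 2) (φ 4))) /
    (det3 (φ 0) (φ 1) (φ 4) * det3 (φ 0) (φ 2) (φ 3))

/-- The invariant `s₂` of five vectors in `ℂ^3`. -/
noncomputable def s2 (φ : Fin 5 → Fin 3 → ℂ) : ℂ :=
  (-(det3 (φ 0) (φ 1) (φ 2) * det3 (φ 1) (φ 3) (φ 4))) /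
    (det3 (φ 0) (φ 1) (φ 3) * det3 (φ 1) (φ 2) (φ 4))

/-- The invariant `s₃` of five vectors in `ℂ^3`. -/
noncomputable def s3 (ψ : Fin 5 → Fin 3 → ℂ) : ℂ :=
  (-(det3 (ψ 0) (ψ 2) (ψ 1) * det3 (ψ 0) (ψ 4) (ψ 3))) /
    (det3 (ψ 0) (ψ 2) (ψ 3) * det3 (ψ 0) (ψ 4) (ψ 1))

/-- The invariant `s₄` of five vectors in `ℂ^3`. -/
noncomputable def s4 (ψ : Fin 5 → Fin 3 → ℂ) : ℂ :=
  (-(det3 (ψ 0) (ψ 2) (ψ 4) * det3 (ψ 2) (ψ 1) (ψ 3))) /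
    (det3 (ψ 0) (ψ 2) (ψ 1) * det3 (ψ 2) (ψ 4) (ψ 3))

/-- A complex number is a positive real. -/
def IsPosReal (z : ℂ) : Prop := z.im = 0 ∧ 0 < z.re

theorem det3_eq (u v w : Fin 3 → ℂ) :
    det3 u v w = u 0 * (v 1 * w 2 - v 2 * w 1) - v 0 * (u 1 * w 2 - u 2 * w 1)
      + w 0 * (u 1 * v 2 - u 2 * v 1) := by
  simp [det3, Matrix.det_fin_three]
  ring

theorem hinner_fin_three (x y : Fin 3 → ℂ) :
    hinner x y = conj (x 0) * y 0 + conj (x 1) * y 1 + conj (x 2) * y 2 := by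
  simp [hinner, Fin.sum_univ_three]

theorem conj_hinner {α : Type*} [Fintype α] (x y : α → ℂ) :
    conj (hinner x y) = hinner y x := by
  simp [hinner, mul_comm]

theorem hinner_eq_zero_symm {α : Type*} [Fintype α] {x y : α → ℂ} (h : hinner x y = 0) :
    hinner y x = 0 := by
  rw [← conj_hinner, h, map_zero]

theorem hinner_smul_smul {α : Type*} [Fintype α] (a b : ℂ) (x y : α → ℂ) :
    hinner (a • x) (b • y) = conj a * b * hinner x y := by
  simp only [hinner, Pi.smul_apply, smul_eq_mul, map_mul, Finset.mul_sum]
  exact Finset.sum_congr rfl fun _ _ => by ring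

theorem hinner_prodVec {n m : ℕ} (a c : Fin n → ℂ) (b d : Fin m → ℂ) :
    hinner (prodVec a b) (prodVec c d) = hinner a c * hinner b d := by
  simp only [hinner, prodVec, Fintype.sum_prod_type, Finset.sum_mul_sum, map_mul]
  exact Finset.sum_congr rfl fun _ _ => Finset.sum_congr rfl fun _ _ => by ring

theorem exists_hinner_self {x : Fin 3 → ℂ} (hx : x ≠ 0) :
    ∃ r : ℝ, 0 < r ∧ hinner x x = r := by
  refine ⟨∑ i, Complex.normSq (x i), ?_, ?_⟩
  · obtain ⟨i, hi⟩ := Function.ne_iff.mp hx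
    exact Finset.sum_pos' (fun j _ => Complex.normSq_nonneg _)
      ⟨i, Finset.mem_univ _, Complex.normSq_pos.mpr hi⟩
  · simp [hinner, Complex.normSq_eq_conj_mul_self]

theorem det3_mulVec (A : Matrix (Fin 3) (Fin 3) ℂ) (u v w : Fin 3 → ℂ) :
    det3 (A.mulVec u) (A.mulVec v) (A.mulVec w) = A.det * det3 u v w := by
  rw [det3, det3, ← Matrix.det_mul]
  congr 1
  ext i j
  fin_cases j <;> simp [Matrix.mul_apply, Matrix.mulVec, dotProduct]

theorem det3_ne_zero_of_linearIndependent {u v w : Fin 3 → ℂ}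
    (h : LinearIndependent ℂ ![u, v, w]) : det3 u v w ≠ 0 := by
  have := Matrix.linearIndependent_rows_iff_isUnit (A := Matrix.of ![u, v, w]).mp h
  rw [Matrix.isUnit_iff_isUnit_det, isUnit_iff_ne_zero, ← Matrix.det_transpose] at this
  exact this

theorem det3_ne_zero_of_triples {φ : Fin 5 → Fin 3 → ℂ}
    (hφ : ∀ S : Finset (Fin 5), S.card = 3 →
      LinearIndependent ℂ (fun i : {x // x ∈ S} => φ i.1))
    (i j k : Fin 5) (hij : i ≠ j) (hik : i ≠ k) (hjk : j ≠ k) :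
    det3 (φ i) (φ j) (φ k) ≠ 0 := by
  apply det3_ne_zero_of_linearIndependent
  have hmem : ∀ a : Fin 3, ![i, j, k] a ∈ ({i, j, k} : Finset (Fin 5)) := by
    intro a; fin_cases a <;> simp
  have hinj : Function.Injective
      (fun a : Fin 3 => (⟨![i, j, k] a, hmem a⟩ : {x // x ∈ ({i, j, k} : Finset (Fin 5))})) := by
    intro a b hab
    have hab' : ![i, j, k] a = ![i, j, k] b := congrArg Subtype.val hab
    revert hab'
    fin_cases a <;> fin_cases b <;> simp [hij, hik, hjk, hij.symm, hik.symm, hjk.symm]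
  convert (hφ _ (Finset.card_eq_three.mpr ⟨i, j, k, hij, hik, hjk, rfl⟩)).comp _ hinj using 1
  ext a b
  fin_cases a <;> rfl

theorem eq_zero_of_hinner_eq_zero {u v w f : Fin 3 → ℂ} (h : det3 u v w ≠ 0)
    (hu : hinner u f = 0) (hv : hinner v f = 0) (hw : hinner w f = 0) : f = 0 := by
  have hM : (Matrix.of ![star u, star v, star w]).det = conj (det3 u v w) := by
    rw [det3_eq, Matrix.det_fin_three]
    simp
    ring
  refine Matrix.eq_zero_of_mulVec_eq_zero (M := Matrix.of ![star u, star v, star w]) ?_ ?_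
  · rw [hM]
    simpa using h
  · ext i
    fin_cases i
    · exact hu
    · exact hv
    · exact hw

/-- The Gram determinant, for two triples sharing their first two vectors. -/
theorem conj_det3_mul_det3 (u v x y : Fin 3 → ℂ) :
    conj (det3 u v x) * det3 u v y =
      hinner u u * (hinner v v * hinner x y - hinner v y * hinner x v)
      - hinner u v * (hinner v u * hinner x y - hinner v y * hinner x u)
      + hinner u y * (hinner v u * hinner x v - hinner v v * hinner x u) := by
  simp only [det3_eq, hinner_fin_three, map_add, map_sub, map_mul]
  ring

theorem hinner_mul_det3 (z u v w x : Fin 3 → ℂ) :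
    hinner z x * det3 u v w =
      hinner z u * det3 x v w + hinner z v * det3 u x w + hinner z w * det3 u v x := by
  simp only [det3_eq, hinner_fin_three]
  ring

theorem isPosReal_iff_exists {a b c d : ℂ} (ha : a ≠ 0) (hb : b ≠ 0) (hc : c ≠ 0) :
    IsPosReal (-(a * d) / (b * c)) ↔ ∃ r : ℝ, 0 < r ∧ conj a * b + r * (conj c * d) = 0 := by
  have hca : conj a ≠ 0 := by simpa using ha
  have hcc : conj c ≠ 0 := by simpa using hc
  have hna := Complex.normSq_pos.mpr ha
  have hnc := Complex.normSq_pos.mpr hc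
  constructor
  · rintro ⟨him, hre⟩
    set s := (-(a * d) / (b * c)).re with hs
    have hz : -(a * d) / (b * c) = (s : ℂ) := Complex.ext (by simp [hs]) (by simpa using him)
    have hs0 : (s : ℂ) ≠ 0 := by exact_mod_cast hre.ne'
    refine ⟨Complex.normSq a / (Complex.normSq c * s), by positivity, ?_⟩
    push_cast
    rw [Complex.normSq_eq_conj_mul_self, Complex.normSq_eq_conj_mul_self]
    rw [div_eq_iff (mul_ne_zero hb hc)] at hz
    field_simp
    linear_combination (-conj a) * hz
  · rintro ⟨r, hr, h⟩
    have hr0 : (r : ℂ) ≠ 0 := by exact_mod_cast hr.ne'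
    have hz : -(a * d) / (b * c) = ((Complex.normSq a / (Complex.normSq c * r) : ℝ) : ℂ) := by
      push_cast
      rw [Complex.normSq_eq_conj_mul_self, Complex.normSq_eq_conj_mul_self]
      field_simp
      linear_combination -h
    rw [hz]
    exact ⟨Complex.ofReal_im _, by rw [Complex.ofReal_re]; positivity⟩

/-- For a cyclically orthogonal pentagon `u, v, x, y, w`, two products of its volumes have
opposite arguments. -/
theorem exists_pos_of_pentagon {u v x y w : Fin 3 → ℂ} (huvw : det3 u v w ≠ 0)
    (huv : hinner u v = 0) (hvx : hinner v x = 0) (hxy : hinner x y = 0)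
    (hwu : hinner w u = 0) :
    ∃ r : ℝ, 0 < r ∧
      conj (det3 u v x) * det3 u v y + r * (conj (det3 v x w) * det3 v y w) = 0 := by
  have hu : u ≠ 0 := by
    rintro rfl
    simp [det3_eq] at huvw
  have hv : v ≠ 0 := by
    rintro rfl
    simp [det3_eq] at huvw
  obtain ⟨p, hp, hpu⟩ := exists_hinner_self hu
  obtain ⟨q, hq, hqv⟩ := exists_hinner_self hv
  have hvol := Complex.normSq_pos.mpr huvw
  have hswap (z : Fin 3 → ℂ) : hinner u z * det3 u v w = -(p * det3 v z w) := by
    rw [hinner_mul_det3 u u v w z, huv, hinner_eq_zero_symm hwu, hpu]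
    simp only [det3_eq]
    ring
  have hgram := conj_det3_mul_det3 u v x y
  rw [huv, hinner_eq_zero_symm hvx, hxy, hqv, ← conj_hinner u x] at hgram
  have hx := congrArg conj (hswap x)
  simp only [map_mul, map_neg, Complex.conj_ofReal] at hx
  have hcvol : conj (det3 u v w) ≠ 0 := by simpa using huvw
  refine ⟨q * p ^ 2 / Complex.normSq (det3 u v w), by positivity, ?_⟩
  push_cast
  rw [Complex.normSq_eq_conj_mul_self, hgram]
  field_simp
  linear_combination (-q * hinner u y * det3 u v w) * hx + (q * p * conj (det3 v x w)) * hswap y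

theorem det3_swap_left (u v w : Fin 3 → ℂ) : det3 v u w = -det3 u v w := by
  simp only [det3_eq]; ring

theorem det3_swap_right (u v w : Fin 3 → ℂ) : det3 u w v = -det3 u v w := by
  simp only [det3_eq]; ring

theorem isPosReal_s1_iff {φ : Fin 5 → Fin 3 → ℂ}
    (hφ : ∀ i j k, i ≠ j → i ≠ k → j ≠ k → det3 (φ i) (φ j) (φ k) ≠ 0) :
    IsPosReal (s1 φ) ↔ ∃ r : ℝ, 0 < r ∧
      conj (det3 (φ 0) (φ 1) (φ 4)) * det3 (φ 0) (φ 1) (φ 3)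
        + r * (conj (det3 (φ 0) (φ 2) (φ 4)) * det3 (φ 0) (φ 2) (φ 3)) = 0 := by
  rw [s1, isPosReal_iff_exists (by apply hφ <;> decide) (by apply hφ <;> decide)
    (by apply hφ <;> decide)]
  refine exists_congr fun r => and_congr_right fun _ => ?_
  rw [← map_eq_zero (starRingEnd ℂ)]
  simp only [map_add, map_mul, Complex.conj_conj, Complex.conj_ofReal, mul_comm]

theorem isPosReal_s2_iff {φ : Fin 5 → Fin 3 → ℂ}
    (hφ : ∀ i j k, i ≠ j → i ≠ k → j ≠ k → det3 (φ i) (φ j) (φ k) ≠ 0) :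
    IsPosReal (s2 φ) ↔ ∃ r : ℝ, 0 < r ∧
      conj (det3 (φ 0) (φ 1) (φ 2)) * det3 (φ 0) (φ 1) (φ 3)
        + r * (conj (det3 (φ 1) (φ 2) (φ 4)) * det3 (φ 1) (φ 3) (φ 4)) = 0 := by
  rw [s2, isPosReal_iff_exists (by apply hφ <;> decide) (by apply hφ <;> decide)
    (by apply hφ <;> decide)]

theorem isPosReal_of_cyclic {v : Fin 5 → Fin 3 → ℂ}
    (hv : ∀ i j k, i ≠ j → i ≠ k → j ≠ k → det3 (v i) (v j) (v k) ≠ 0)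
    (h : ∀ i, hinner (v i) (v (i + 1)) = 0) : IsPosReal (s1 v) ∧ IsPosReal (s2 v) := by
  rw [isPosReal_s1_iff hv, isPosReal_s2_iff hv]
  constructor
  · obtain ⟨r, hr, h0⟩ := exists_pos_of_pentagon (u := v 1) (v := v 0) (x := v 4) (y := v 3)
      (w := v 2) (by apply hv <;> decide) (hinner_eq_zero_symm (h 0)) (hinner_eq_zero_symm (h 4))
      (hinner_eq_zero_symm (h 3)) (hinner_eq_zero_symm (h 1))
    refine ⟨r, hr, ?_⟩
    rw [det3_swap_left (v 0) (v 1), det3_swap_left (v 0) (v 1), det3_swap_right (v 0) (v 2),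
      det3_swap_right (v 0) (v 2)] at h0
    simpa using h0
  · exact exists_pos_of_pentagon (by apply hv <;> decide) (h 0) (h 1) (h 2) (h 4)

theorem s1_mulVec {A : Matrix (Fin 3) (Fin 3) ℂ} (hA : A.det = 1) (φ : Fin 5 → Fin 3 → ℂ) :
    s1 (fun i => A.mulVec (φ i)) = s1 φ := by
  simp [s1, det3_mulVec, hA]

theorem s2_mulVec {A : Matrix (Fin 3) (Fin 3) ℂ} (hA : A.det = 1) (φ : Fin 5 → Fin 3 → ℂ) :
    s2 (fun i => A.mulVec (φ i)) = s2 φ := by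
  simp [s2, det3_mulVec, hA]

theorem exists_mulVec_eq_det3 (p q r s t u : Fin 3 → ℂ) (a b : ℂ) :
    ∃ M : Matrix (Fin 3) (Fin 3) ℂ, ∀ x,
      M.mulVec x = ![a * det3 x p q, b * det3 x r s, det3 x t u] := by
  refine ⟨Matrix.of fun i j => ![a * det3 (Pi.single j 1) p q, b * det3 (Pi.single j 1) r s,
    det3 (Pi.single j 1) t u] i, fun x => ?_⟩
  ext i
  fin_cases i <;>
    simp [Matrix.mulVec, dotProduct, Fin.sum_univ_three, det3_eq, Pi.single_apply] <;> ring

theorem exists_det_eq_one_of_det_ne_zero {φ : Fin 5 → Fin 3 → ℂ}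
    {M : Matrix (Fin 3) (Fin 3) ℂ} (hM : M.det ≠ 0)
    (h : ∀ i, hinner (M.mulVec (φ i)) (M.mulVec (φ (i + 1))) = 0) :
    ∃ A : Matrix (Fin 3) (Fin 3) ℂ, A.det = 1 ∧
      ∀ i, hinner (A.mulVec (φ i)) (A.mulVec (φ (i + 1))) = 0 := by
  obtain ⟨z, hz⟩ := IsAlgClosed.exists_pow_nat_eq M.det⁻¹ (n := 3) (by norm_num)
  refine ⟨z • M, ?_, fun i => ?_⟩
  · simp [hz, hM]
  · rw [Matrix.smul_mulVec, Matrix.smul_mulVec, hinner_smul_smul, h, mul_zero]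

theorem exists_cyclic_of_isPosReal {φ : Fin 5 → Fin 3 → ℂ}
    (hφ : ∀ i j k, i ≠ j → i ≠ k → j ≠ k → det3 (φ i) (φ j) (φ k) ≠ 0)
    (h1 : IsPosReal (s1 φ)) (h2 : IsPosReal (s2 φ)) :
    ∃ A : Matrix (Fin 3) (Fin 3) ℂ, A.det = 1 ∧
      ∀ i, hinner (A.mulVec (φ i)) (A.mulVec (φ (i + 1))) = 0 := by
  obtain ⟨b, hb, hb0⟩ := (isPosReal_s1_iff hφ).mp h1
  obtain ⟨a, ha, ha0⟩ := (isPosReal_s2_iff hφ).mp h2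
  have hsqrt {r : ℝ} (hr : 0 < r) : (√r : ℂ) * √r = r := by
    exact_mod_cast Real.mul_self_sqrt hr.le
  have hsqrt0 {r : ℝ} (hr : 0 < r) : (√r : ℂ) ≠ 0 := by
    exact_mod_cast (Real.sqrt_pos.mpr hr).ne'
  obtain ⟨M, hM⟩ := exists_mulVec_eq_det3 (φ 1) (φ 4) (φ 0) (φ 2) (φ 0) (φ 1) √a √b
  have hself (x y : Fin 3 → ℂ) : det3 x x y = 0 ∧ det3 x y x = 0 := by
    simp only [det3_eq]; constructor <;> ring
  refine exists_det_eq_one_of_det_ne_zero (M := M) ?_ ?_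
  · intro hdet
    have h := det3_mulVec M (φ 0) (φ 1) (φ 2)
    rw [hdet, zero_mul, hM, hM, hM, det3_eq] at h
    simp only [Matrix.cons_val, (hself _ _).1, (hself _ _).2] at h
    have h014 := hφ 0 1 4 (by decide) (by decide) (by decide)
    have h102 := hφ 1 0 2 (by decide) (by decide) (by decide)
    have h201 := hφ 2 0 1 (by decide) (by decide) (by decide)
    simp [hsqrt0 ha, hsqrt0 hb, h014, h102, h201] at h
  · have e1 : det3 (φ 2) (φ 0) (φ 1) = det3 (φ 0) (φ 1) (φ 2) := by simp only [det3_eq]; ring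
    have e2 : det3 (φ 3) (φ 0) (φ 1) = det3 (φ 0) (φ 1) (φ 3) := by simp only [det3_eq]; ring
    have e3 : det3 (φ 4) (φ 0) (φ 1) = det3 (φ 0) (φ 1) (φ 4) := by simp only [det3_eq]; ring
    have e4 : det3 (φ 3) (φ 0) (φ 2) = det3 (φ 0) (φ 2) (φ 3) := by simp only [det3_eq]; ring
    have e5 : det3 (φ 4) (φ 0) (φ 2) = det3 (φ 0) (φ 2) (φ 4) := by simp only [det3_eq]; ring
    have ha' := hsqrt ha
    have hb' := hsqrt hb
    intro i
    fin_cases i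
    · simp [hM, hinner_fin_three, hself]
    · simp [hM, hinner_fin_three, hself]
    · simp [hM, hinner_fin_three, hself, e1, e2, det3_swap_left (φ 1) (φ 2),
        det3_swap_left (φ 1) (φ 3)]
      linear_combination ha0 + (conj (det3 (φ 1) (φ 2) (φ 4)) * det3 (φ 1) (φ 3) (φ 4)) * ha'
    · apply hinner_eq_zero_symm
      simp [hM, hinner_fin_three, hself, e2, e3, e4, e5]
      linear_combination hb0 + (conj (det3 (φ 0) (φ 2) (φ 4)) * det3 (φ 0) (φ 2) (φ 3)) * hb'
    · simp [hM, hinner_fin_three, hself]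

theorem exists_cyclic_iff {φ : Fin 5 → Fin 3 → ℂ}
    (hφ : ∀ i j k, i ≠ j → i ≠ k → j ≠ k → det3 (φ i) (φ j) (φ k) ≠ 0) :
    (∃ A : Matrix (Fin 3) (Fin 3) ℂ, A.det = 1 ∧
      ∀ i, hinner (A.mulVec (φ i)) (A.mulVec (φ (i + 1))) = 0) ↔
      IsPosReal (s1 φ) ∧ IsPosReal (s2 φ) := by
  refine ⟨fun ⟨A, hA, h⟩ => ?_, fun h => exists_cyclic_of_isPosReal hφ h.1 h.2⟩
  rw [← s1_mulVec hA, ← s2_mulVec hA]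
  refine isPosReal_of_cyclic (fun i j k hij hik hjk => ?_) h
  rw [det3_mulVec, hA, one_mul]
  exact hφ i j k hij hik hjk

theorem not_exists_product_orthogonal {v w : Fin 5 → Fin 3 → ℂ}
    (hv : ∀ i j k, i ≠ j → i ≠ k → j ≠ k → det3 (v i) (v j) (v k) ≠ 0)
    (hw : ∀ i j k, i ≠ j → i ≠ k → j ≠ k → det3 (w i) (w j) (w k) ≠ 0) :
    ¬ ∃ f g : Fin 3 → ℂ, f ≠ 0 ∧ g ≠ 0 ∧ ∀ i, hinner (v i) f * hinner (w i) g = 0 := by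
  classical
  rintro ⟨f, g, hf, hg, h⟩
  have key {z : Fin 5 → Fin 3 → ℂ} {f : Fin 3 → ℂ}
      (hz : ∀ i j k, i ≠ j → i ≠ k → j ≠ k → det3 (z i) (z j) (z k) ≠ 0) (hf : f ≠ 0) :
      (Finset.univ.filter fun i => hinner (z i) f = 0).card ≤ 2 := by
    by_contra! hcard
    obtain ⟨i, hi, j, hj, k, hk, hij, hik, hjk⟩ := Finset.two_lt_card.mp hcard
    simp only [Finset.mem_filter, Finset.mem_univ, true_and] at hi hj hk
    exact hf (eq_zero_of_hinner_eq_zero (hz i j k hij hik hjk) hi hj hk)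
  have huniv : (Finset.univ.filter fun i => hinner (v i) f = 0) ∪
      (Finset.univ.filter fun i => hinner (w i) g = 0) = Finset.univ := by
    ext i
    simpa using h i
  have hcard := Finset.card_union_le (Finset.univ.filter fun i => hinner (v i) f = 0)
    (Finset.univ.filter fun i => hinner (w i) g = 0)
  rw [huniv, Finset.card_fin] at hcard
  have := key hv hf
  have := key hw hg
  omega

theorem stmt14 (φ ψ : Fin 5 → Fin 3 → ℂ)
    (hφ : ∀ S : Finset (Fin 5), S.card = 3 →
      LinearIndependent ℂ (fun i : {x // x ∈ S} => φ i.1))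
    (hψ : ∀ S : Finset (Fin 5), S.card = 3 →
      LinearIndependent ℂ (fun i : {x // x ∈ S} => ψ i.1)) :
    (∃ (A B : Matrix (Fin 3) (Fin 3) ℂ) (c : Fin 5 → ℂ),
      A.det = 1 ∧ B.det = 1 ∧ (∀ i, c i ≠ 0) ∧
      (∀ i : Fin 5,
        hinner (c i • A.mulVec (φ i)) (c (i + 1) • A.mulVec (φ (i + 1))) = 0) ∧
      (∀ j : Fin 5, hinner (B.mulVec (ψ j)) (B.mulVec (ψ (j + 2))) = 0) ∧
      (∀ i j : Fin 5, i ≠ j →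
        hinner (prodVec (c i • A.mulVec (φ i)) (B.mulVec (ψ i)))
          (prodVec (c j • A.mulVec (φ j)) (B.mulVec (ψ j))) = 0) ∧
      ¬ ∃ (f g : Fin 3 → ℂ), f ≠ 0 ∧ g ≠ 0 ∧
        ∀ i, hinner (prodVec (c i • A.mulVec (φ i)) (B.mulVec (ψ i)))
          (prodVec f g) = 0) ↔
      (IsPosReal (s1 φ) ∧ IsPosReal (s2 φ) ∧ IsPosReal (s3 ψ) ∧ IsPosReal (s4 ψ)) := by
  have hφ' := det3_ne_zero_of_triples hφ
  have hψ' := det3_ne_zero_of_triples hψ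
  have hdouble : Function.Injective fun k : Fin 5 => 2 * k := by decide
  have hχ : ∀ i j k, i ≠ j → i ≠ k → j ≠ k →
      det3 (ψ (2 * i)) (ψ (2 * j)) (ψ (2 * k)) ≠ 0 := fun i j k hij hik hjk =>
    hψ' _ _ _ (hdouble.ne hij) (hdouble.ne hik) (hdouble.ne hjk)
  have hs : IsPosReal (s3 ψ) ∧ IsPosReal (s4 ψ) ↔
      IsPosReal (s1 fun k => ψ (2 * k)) ∧ IsPosReal (s2 fun k => ψ (2 * k)) := Iff.rfl
  rw [hs, ← exists_cyclic_iff hχ, ← and_assoc, ← exists_cyclic_iff hφ']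
  constructor
  · rintro ⟨A, B, c, hA, hB, hc, hAφ, hBψ, -, -⟩
    refine ⟨⟨A, hA, fun i => ?_⟩, B, hB, fun i => ?_⟩
    · simpa [hinner_smul_smul, hc] using hAφ i
    · rw [mul_add]
      exact hBψ (2 * i)
  · rintro ⟨⟨A, hA, hAφ⟩, B, hB, hBχ⟩
    have hBψ : ∀ j, hinner (B.mulVec (ψ j)) (B.mulVec (ψ (j + 2))) = 0 := by
      intro j
      have hj : ∀ j : Fin 5, 2 * (3 * j) = j ∧ 2 * (3 * j + 1) = j + 2 := by decide
      have h := hBχ (3 * j)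
      rwa [(hj j).1, (hj j).2] at h
    refine ⟨A, B, 1, hA, hB, by simp, by simpa using hAφ, hBψ, fun i j hij => ?_, ?_⟩
    · rw [hinner_prodVec, hinner_smul_smul]
      have hcases : ∀ i j : Fin 5, i ≠ j → j = i + 1 ∨ i = j + 1 ∨ j = i + 2 ∨ i = j + 2 := by
        decide
      rcases hcases i j hij with rfl | rfl | rfl | rfl
      · simp [hAφ]
      · simp [hinner_eq_zero_symm (hAφ _)]
      · simp [hBψ]
      · simp [hinner_eq_zero_symm (hBψ _)]
    · simp only [Pi.one_apply, one_smul, hinner_prodVec]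
      refine not_exists_product_orthogonal (v := fun i => A.mulVec (φ i))
        (w := fun i => B.mulVec (ψ i)) (fun i j k hij hik hjk => ?_) fun i j k hij hik hjk => ?_
      · rw [det3_mulVec, hA, one_mul]
        exact hφ' i j k hij hik hjk
      · rw [det3_mulVec, hB, one_mul]
        exact hψ' i j k hij hik hjk
end

section
/- Let n ≥ 1 and let ρ be a PPT state on ℂ^2 ⊗ ℂ^n. Then the range of ρ contains a nonzero product vector; that is, there exist nonzero φ ∈ ℂ^2 and ψ ∈ ℂ^n with φ ⊗ ψ in the range of ρ. In particular, the range of a PPT state on ℂ^2 ⊗ ℂ^n is never a completely entangled subspace. -/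
open scoped ComplexConjugate ComplexOrder

/-- The partial transpose with respect to the first subsystem:
`ρ^{T1}((i,j),(k,l)) = ρ((k,j),(i,l))`. -/
noncomputable def pt {n m : ℕ} (ρ : Matrix (Fin n × Fin m) (Fin n × Fin m) ℂ) :
    Matrix (Fin n × Fin m) (Fin n × Fin m) ℂ :=
  Matrix.of fun a b => ρ (b.1, a.2) (a.1, b.2)

theorem Matrix.mulVecLin_eq_zero_iff {R m n : Type*} [CommSemiring R] [Fintype n]
    {A : Matrix m n R} : A.mulVecLin = 0 ↔ A = 0 := by
  refine ⟨fun h => Matrix.mulVec_injective ?_, fun h => h ▸ Matrix.mulVecLin_zero⟩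
  ext x i
  simpa using congrFun (LinearMap.congr_fun h x) i

open scoped MatrixOrder in
/-- Restricting a vector in the range of a positive semidefinite matrix to a set of coordinates gives
a vector in the range of the corresponding principal submatrix. -/
theorem Matrix.PosSemidef.exists_submatrix_mulVec_eq {m k : Type*} [Fintype m] [Fintype k]
    {σ : Matrix m m ℂ} (hσ : σ.PosSemidef) (f : k → m) (y : m → ℂ) :
    ∃ x : k → ℂ, (σ.submatrix f f).mulVec x = σ.mulVec y ∘ f := by
  classical
  obtain ⟨D, rfl⟩ := CStarAlgebra.nonneg_iff_eq_star_mul_self.mp hσ.nonneg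
  rw [Matrix.star_eq_conjTranspose]
  set E := D.submatrix id f
  have hE : (D.conjTranspose * D).submatrix f f = E.conjTranspose * E := rfl
  have hle : LinearMap.range (E.conjTranspose * E).mulVecLin ≤
      LinearMap.range E.conjTranspose.mulVecLin := by
    rw [Matrix.mulVecLin_mul]
    exact LinearMap.range_comp_le_range _ _
  have heq := Submodule.eq_of_le_of_finrank_eq hle
    (E.rank_conjTranspose_mul_self.trans E.rank_conjTranspose.symm)
  have hmem : (D.conjTranspose * D).mulVec y ∘ f ∈ LinearMap.range E.conjTranspose.mulVecLin := by
    refine ⟨D.mulVec y, ?_⟩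
    rw [← Matrix.mulVec_mulVec]
    rfl
  rw [← heq] at hmem
  rw [hE]
  exact hmem

/-- A linear pencil `M - μ A` with `range M ≤ range A` and `A ≠ 0` has an eigenvector outside the
kernel of `A`. -/
theorem LinearMap.exists_eq_smul_of_range_le {K V W : Type*} [Field K] [IsAlgClosed K]
    [AddCommGroup V] [Module K V] [AddCommGroup W] [Module K W] [FiniteDimensional K W]
    {A M : V →ₗ[K] W} (hA : A ≠ 0) (hM : LinearMap.range M ≤ LinearMap.range A) :
    ∃ (μ : K) (x : V), A x ≠ 0 ∧ M x = μ • A x := by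
  obtain ⟨g, hg⟩ := A.rangeRestrict.exists_rightInverse_of_surjective A.range_rangeRestrict
  have hAg (w : LinearMap.range A) : A (g w) = w := congrArg Subtype.val (LinearMap.congr_fun hg w)
  have : Nontrivial (LinearMap.range A) :=
    Submodule.nontrivial_iff_ne_bot.mpr (mt LinearMap.range_eq_bot.mp hA)
  let T : Module.End K (LinearMap.range A) :=
    (M ∘ₗ g).codRestrict _ fun w => hM ⟨g w, rfl⟩
  obtain ⟨μ, hμ⟩ := Module.End.exists_eigenvalue T
  obtain ⟨w, hw⟩ := hμ.exists_hasEigenvector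
  refine ⟨μ, g w, ?_, ?_⟩
  · rw [hAg]
    simpa using hw.2
  · rw [hAg]
    exact congrArg Subtype.val hw.apply_eq_smul

theorem stmt19 (n : ℕ) (hn : 1 ≤ n)
    (ρ : Matrix (Fin 2 × Fin n) (Fin 2 × Fin n) ℂ)
    (hne : ρ ≠ 0) (hpsd : ρ.PosSemidef) (hppt : (pt ρ).PosSemidef) :
    ∃ (φ : Fin 2 → ℂ) (ψ : Fin n → ℂ), φ ≠ 0 ∧ ψ ≠ 0 ∧
      ∃ x, ρ.mulVec x = prodVec φ ψ := by
  let A : Matrix (Fin n) (Fin n) ℂ := ρ.submatrix (Prod.mk 0) (Prod.mk 0)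
  let M : Matrix (Fin n) (Fin n) ℂ := ρ.submatrix (Prod.mk 1) (Prod.mk 0)
  have hrange : LinearMap.range M.mulVecLin ≤ LinearMap.range A.mulVecLin := by
    rintro _ ⟨x, rfl⟩
    obtain ⟨z, hz⟩ := hppt.exists_submatrix_mulVec_eq (Prod.mk 0) (fun p => ![0, x p.2] p.1)
    refine ⟨z, hz.trans ?_⟩
    ext i
    simp [Matrix.mulVec, dotProduct, Fintype.sum_prod_type, pt, M]
  by_cases hA : A = 0
  · have hM : M = 0 := by
      rw [hA, Matrix.mulVecLin_zero, LinearMap.range_zero, le_bot_iff,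
        LinearMap.range_eq_bot] at hrange
      exact Matrix.mulVecLin_eq_zero_iff.mp hrange
    have h00 (i j) : ρ (0, i) (0, j) = 0 := congrFun₂ hA i j
    have h10 (i j) : ρ (1, i) (0, j) = 0 := congrFun₂ hM i j
    have h01 (i j) : ρ (0, i) (1, j) = 0 := by
      rw [← hpsd.isHermitian.apply, h10, star_zero]
    obtain ⟨j, hj⟩ : ∃ j, (fun i => ρ (1, i) (1, j)) ≠ 0 := by
      by_contra! h
      refine hne (Matrix.ext ?_)
      rintro ⟨a, i⟩ ⟨b, j⟩
      fin_cases a <;> fin_cases b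
      exacts [h00 i j, h01 i j, h10 i j, congrFun (h j) i]
    refine ⟨![0, 1], _, by simp, hj, Pi.single (1, j) 1, ?_⟩
    ext ⟨a, i⟩
    fin_cases a <;> simp [prodVec, h01]
  · obtain ⟨μ, x, hx, hμ⟩ := LinearMap.exists_eq_smul_of_range_le
      (mt Matrix.mulVecLin_eq_zero_iff.mp hA) hrange
    refine ⟨![1, μ], _, by simp, hx, fun p => ![x p.2, 0] p.1, ?_⟩
    ext ⟨a, i⟩
    have hμi := congrFun hμ i
    fin_cases a
    · simp [prodVec, Matrix.mulVec, dotProduct, Fintype.sum_prod_type, A]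
    · simpa [prodVec, Matrix.mulVec, dotProduct, Fintype.sum_prod_type, A, M] using hμi
end
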